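/- Let q : {0,1}^n → ℝ, let R̃ = H · diag(q) · H, and let W be the 2^n × 2^n matrix with W_{xy} = |x| − |y|. Then ‖B_q‖ = ‖W ⊙ R̃‖, where ⊙ denotes the entrywise (Hadamard) product. -/

import Mathlib

noncomputable def specNorm {I : Type*} [Fintype I] [DecidableEq I] (A : Matrix I I ℝ) : ℝ :=
  ‖Matrix.toEuclideanCLM (𝕜 := ℝ) A‖

/-- Adjacency matrix of the sensitivity graph of `f`. -/
def sensAdj {I : Type*} [Fintype I] [DecidableEq I] (f : (I → Bool) → Bool) :
    Matrix (I → Bool) (I → Bool) ℝ :=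
  Matrix.of fun x y => if hammingDist x y = 1 ∧ f x ≠ f y then (1 : ℝ) else 0

/-- Spectral sensitivity `λ(f)`: the ℓ2→ℓ2 operator norm of the adjacency matrix of the
sensitivity graph of `f`. -/
noncomputable def specSens {I : Type*} [Fintype I] [DecidableEq I] (f : (I → Bool) → Bool) : ℝ :=
  specNorm (sensAdj f)

/-- Hamming weight of `x ∈ {0,1}^n`. -/
def wt {n : ℕ} (x : Fin n → Bool) : ℕ := (Finset.univ.filter fun i => x i).card

/-- The `2^n × 2^n` Hadamard matrix: `H x y = (-1)^⟨x,y⟩ · 2^{-n/2}`. -/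
noncomputable def Hmat (n : ℕ) : Matrix (Fin n → Bool) (Fin n → Bool) ℝ :=
  Matrix.of fun x y =>
    (-1 : ℝ) ^ ((Finset.univ.filter fun i => x i ∧ y i).card) / Real.sqrt (2 ^ n)

/-- The diagonal matrix `X` with `X x x = |x|` (Hamming weight). -/
noncomputable def Xm (n : ℕ) : Matrix (Fin n → Bool) (Fin n → Bool) ℝ :=
  Matrix.diagonal fun x => (wt x : ℝ)

/-- The matrix `B_q` built from `q : {0,1}^n → ℝ`: entry `(x,y)` equals `(q(x)-q(y))/2`
when `x` and `y` differ in exactly one coordinate, and `0` otherwise. -/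
noncomputable def Bq {n : ℕ} (q : (Fin n → Bool) → ℝ) :
    Matrix (Fin n → Bool) (Fin n → Bool) ℝ :=
  Matrix.of fun x y => if hammingDist x y = 1 then (q x - q y) / 2 else 0

open Matrix in
theorem specNorm_conj_of_involutive {I : Type*} [Fintype I] [DecidableEq I]
    {U : Matrix I I ℝ} (hT : Uᵀ = U) (hU : U * U = 1) (A : Matrix I I ℝ) :
    specNorm (U * A * U) = specNorm A := by
  have hstar : star U = U := by
    rw [star_eq_conjTranspose, conjTranspose_eq_transpose_of_trivial, hT]
  have hu : toEuclideanCLM (𝕜 := ℝ) U ∈ unitary (EuclideanSpace ℝ I →L[ℝ] EuclideanSpace ℝ I) := by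
    rw [Unitary.mem_iff, ← map_star, hstar, ← map_mul, hU, map_one]
    exact ⟨rfl, rfl⟩
  unfold specNorm
  rw [map_mul, map_mul, CStarRing.norm_mul_mem_unitary _ hu, CStarRing.norm_mem_unitary_mul _ hu]

theorem hammingDist_eq_one_iff_exists_update_not {I : Type*} [Fintype I] [DecidableEq I]
    (z y : I → Bool) :
    hammingDist z y = 1 ↔ ∃ i, Function.update y i (!y i) = z := by
  unfold hammingDist
  rw [Finset.card_eq_one]
  refine exists_congr fun i => ?_
  rw [Finset.ext_iff, funext_iff]
  refine forall_congr' fun j => ?_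
  by_cases h : j = i
  · subst h
    cases hz : z j <;> cases hy : y j <;> simp [hz, hy]
  · simp [h, eq_comm]

theorem sum_hammingDist_eq_one {I : Type*} [Fintype I] [DecidableEq I]
    (y : I → Bool) (f : (I → Bool) → ℝ) :
    (∑ z, if hammingDist z y = 1 then f z else 0) =
      ∑ i, f (Function.update y i (!y i)) := by
  have hinj : Function.Injective fun i => Function.update y i (!y i) := by
    intro i j h
    by_contra hne
    simpa [Function.update_of_ne hne] using congrFun h i
  rw [← Finset.sum_filter, ← Finset.sum_image (f := f) hinj.injOn]
  refine Finset.sum_congr ?_ fun _ _ => rfl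
  ext z
  simp [hammingDist_eq_one_iff_exists_update_not]

theorem neg_one_pow_card_filter {I : Type*} [Fintype I] (p : I → Prop) [DecidablePred p] :
    (-1 : ℝ) ^ (Finset.univ.filter p).card = ∏ i, if p i then -1 else 1 := by
  rw [Finset.prod_ite]
  simp

theorem Hmat_apply_eq_prod {n : ℕ} (x y : Fin n → Bool) :
    Hmat n x y = (∏ i, if x i ∧ y i then (-1 : ℝ) else 1) / Real.sqrt (2 ^ n) := by
  rw [← neg_one_pow_card_filter]
  rfl

theorem Hmat_transpose (n : ℕ) : (Hmat n).transpose = Hmat n := by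
  ext x y
  simp only [Matrix.transpose_apply, Hmat_apply_eq_prod, and_comm]

theorem Hmat_mul_self (n : ℕ) : Hmat n * Hmat n = 1 := by
  ext x y
  have hs : Real.sqrt (2 ^ n) * Real.sqrt (2 ^ n) = 2 ^ n := Real.mul_self_sqrt (by positivity)
  have key : (∑ z : Fin n → Bool, ∏ i, ((if x i ∧ z i then (-1 : ℝ) else 1) *
      if z i ∧ y i then (-1 : ℝ) else 1)) = ∏ i, if x i = y i then (2 : ℝ) else 0 := by
    rw [← Fintype.prod_sum fun i (b : Bool) =>
      (if x i ∧ b then (-1 : ℝ) else 1) * if b ∧ y i then (-1 : ℝ) else 1]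
    refine Finset.prod_congr rfl fun i _ => ?_
    cases x i <;> cases y i <;> norm_num
  simp only [Matrix.mul_apply, Hmat_apply_eq_prod, div_mul_div_comm, hs, ← Finset.sum_div,
    ← Finset.prod_mul_distrib, key]
  rw [Matrix.one_apply]
  split_ifs with h
  · simp [h]
  · obtain ⟨i, hi⟩ := Function.ne_iff.mp h
    rw [Finset.prod_eq_zero (Finset.mem_univ i) (if_neg hi), zero_div]

theorem Hmat_apply_update_not {n : ℕ} (x y : Fin n → Bool) (i : Fin n) :
    Hmat n x (Function.update y i (!y i)) = (if x i then -1 else 1) * Hmat n x y := by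
  rw [Hmat_apply_eq_prod, Hmat_apply_eq_prod, ← mul_div_assoc,
    ← Finset.mul_prod_erase _ _ (Finset.mem_univ i),
    ← Finset.mul_prod_erase Finset.univ (fun j => if x j ∧ y j then (-1 : ℝ) else 1)
      (Finset.mem_univ i), ← mul_assoc]
  congr 2
  · cases x i <;> cases h : y i <;> simp
  · refine Finset.prod_congr rfl fun j hj => ?_
    rw [Function.update_of_ne (Finset.ne_of_mem_erase hj)]

/-- Adjacency matrix of the `n`-dimensional hypercube. -/
def cubeAdj (n : ℕ) : Matrix (Fin n → Bool) (Fin n → Bool) ℝ :=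
  Matrix.of fun x y => if hammingDist x y = 1 then 1 else 0

theorem sum_ite_neg_one_eq_sub_wt {n : ℕ} (x : Fin n → Bool) :
    (∑ i, if x i then (-1 : ℝ) else 1) = n - 2 * wt x := by
  have h : ∀ i, (if x i then (-1 : ℝ) else 1) = 1 - 2 * if x i then 1 else 0 := by
    intro i
    split_ifs <;> norm_num
  simp only [h, Finset.sum_sub_distrib, ← Finset.mul_sum, Finset.sum_boole, wt]
  simp

theorem Hmat_mul_cubeAdj (n : ℕ) :
    Hmat n * cubeAdj n = (n : ℝ) • Hmat n - (2 : ℝ) • (Xm n * Hmat n) := by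
  ext x y
  simp only [Matrix.mul_apply, cubeAdj, Matrix.of_apply, mul_ite, mul_one, mul_zero]
  rw [sum_hammingDist_eq_one]
  simp only [Hmat_apply_update_not, ← Finset.sum_mul, sum_ite_neg_one_eq_sub_wt,
    Matrix.sub_apply, Matrix.smul_apply, smul_eq_mul, Xm, Matrix.diagonal_mul]
  ring

theorem Hmat_mul_Xm_mul_Hmat (n : ℕ) :
    Hmat n * Xm n * Hmat n = (2⁻¹ : ℝ) • ((n : ℝ) • 1 - cubeAdj n) := by
  have h := congrArg (Hmat n * ·) (Hmat_mul_cubeAdj n)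
  simp only [← mul_assoc, mul_sub, Matrix.mul_smul, Hmat_mul_self, one_mul] at h
  rw [h, sub_sub_cancel, smul_smul]
  norm_num

theorem Bq_eq_commutator {n : ℕ} (q : (Fin n → Bool) → ℝ) :
    Bq q = Hmat n * Xm n * Hmat n * Matrix.diagonal q
      - Matrix.diagonal q * (Hmat n * Xm n * Hmat n) := by
  rw [Hmat_mul_Xm_mul_Hmat]
  ext x y
  simp only [Bq, cubeAdj, Matrix.sub_apply, Matrix.mul_diagonal, Matrix.diagonal_mul,
    Matrix.smul_apply, Matrix.of_apply, Matrix.one_apply, smul_eq_mul]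
  by_cases hxy : x = y
  · subst hxy
    simp [mul_comm]
  · simp only [hxy, if_false]
    split_ifs <;> ring

theorem hadamard_wt_sub_wt {n : ℕ} (R : Matrix (Fin n → Bool) (Fin n → Bool) ℝ) :
    Matrix.hadamard (Matrix.of fun x y : Fin n → Bool => (wt x : ℝ) - (wt y : ℝ)) R =
      Xm n * R - R * Xm n := by
  ext x y
  simp only [Matrix.hadamard_apply, Matrix.of_apply, Matrix.sub_apply, Xm,
    Matrix.diagonal_mul, Matrix.mul_diagonal]
  ring

/-- With `R̃ = H·diag(q)·H` and `W x y = |x| - |y|`, we have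
`‖B_q‖ = ‖W ⊙ R̃‖` (entrywise/Hadamard product). -/
theorem Bq_eq_hadamard (n : ℕ) (q : (Fin n → Bool) → ℝ) :
    specNorm (Bq q) =
      specNorm (Matrix.hadamard
        (Matrix.of fun x y : Fin n → Bool => (wt x : ℝ) - (wt y : ℝ))
        (Hmat n * Matrix.diagonal q * Hmat n)) := by
  rw [hadamard_wt_sub_wt, ← specNorm_conj_of_involutive (Hmat_transpose n) (Hmat_mul_self n)
    (_ - _), Bq_eq_commutator]
  congr 1
  have hH := Hmat_mul_self n
  rw [mul_sub, sub_mul]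
  congr 1
  · simp only [mul_assoc, hH, mul_one]
  · simp only [← mul_assoc, hH, one_mul]
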